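/- Let H = (V, E) be a finite weighted hypergraph and let G be the weighted directed graph obtained from H by the adapted CB-gadget construction. For every subset S ⊆ V, cut_H(S) = min{ cut_G(U) : U ⊆ V̂ with U ∩ V = S }; in particular, for every T ⊆ V̂ with T ∩ V = S one has cut_G(T) ≥ cut_H(S). -/

import Mathlib

open Finset

variable {V ι : Type*} [Fintype V] [DecidableEq V] [Fintype ι] [DecidableEq ι]

/-- The all-or-nothing cut value of a vertex subset `S` in a weighted hypergraph whose
hyperedges are `inc e` with weights `w e`: the total weight of hyperedges split by `S`. -/
noncomputable def cutH (inc : ι → Finset V) (w : ι → ℝ) (S : Finset V) : ℝ :=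
  ∑ e ∈ univ.filter (fun e => ((inc e) ∩ S).Nonempty ∧ ((inc e) \ S).Nonempty), w e

/-- Weighted degree of a vertex: total weight of hyperedges containing it. -/
noncomputable def degH (inc : ι → Finset V) (w : ι → ℝ) (i : V) : ℝ :=
  ∑ e ∈ univ.filter (fun e => i ∈ inc e), w e

/-- Volume of a vertex subset: sum of degrees of its vertices. -/
noncomputable def volH (inc : ι → Finset V) (w : ι → ℝ) (S : Finset V) : ℝ :=
  ∑ i ∈ S, degH inc w i

/-- `ε`: the maximum cardinality of a hyperedge. -/
def epsH (inc : ι → Finset V) : ℕ := univ.sup fun e => (inc e).card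

/-- `ν`: the maximum number of hyperedges containing a single vertex. -/
def nuH (inc : ι → Finset V) : ℕ :=
  univ.sup fun v : V => (univ.filter (fun e => v ∈ inc e)).card

/-- `β = (ε + 1) · ν`. -/
noncomputable def betaH (inc : ι → Finset V) : ℝ := ((epsH inc : ℝ) + 1) * (nuH inc : ℝ)

/-- `μ_H(S) = 2 cut_H(S) / (vol_H(S) + β |S|)`. -/
noncomputable def muH (inc : ι → Finset V) (w : ι → ℝ) (S : Finset V) : ℝ :=
  2 * cutH inc w S / (volH inc w S + betaH inc * (S.card : ℝ))

/-- Edge weights of the weighted directed graph produced by the adapted CB-gadget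
construction. The vertex set is `V̂ = V ⊕ ι ⊕ ι`, where `Sum.inl v` is an original vertex,
`Sum.inr (Sum.inl e)` is the auxiliary node `a_e`, and `Sum.inr (Sum.inr e)` is the auxiliary
node `b_e`. For each `v ∈ inc e` there are edges `(v, a_e)` and `(b_e, v)` of weight `1`,
a self-loop `(a_e, a_e)` of weight `1 - w e`, and an edge `(a_e, b_e)` of weight `w e`.
All other weights are `0`. -/
noncomputable def wG (inc : ι → Finset V) (w : ι → ℝ) :
    (V ⊕ ι ⊕ ι) → (V ⊕ ι ⊕ ι) → ℝ
  | Sum.inl v, Sum.inr (Sum.inl e) => if v ∈ inc e then 1 else 0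
  | Sum.inr (Sum.inr e), Sum.inl v => if v ∈ inc e then 1 else 0
  | Sum.inr (Sum.inl e), Sum.inr (Sum.inl e') => if e = e' then 1 - w e else 0
  | Sum.inr (Sum.inl e), Sum.inr (Sum.inr e') => if e = e' then w e else 0
  | _, _ => 0

/-- Directed cut value in the gadget graph: total weight of edges from `T` to its complement. -/
noncomputable def cutG (inc : ι → Finset V) (w : ι → ℝ) (T : Finset (V ⊕ ι ⊕ ι)) : ℝ :=
  ∑ x ∈ T, ∑ y ∈ Tᶜ, wG inc w x y

/-- Out-degree (total outgoing weight, including self-loops) of a node in the gadget graph. -/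
noncomputable def outdegG (inc : ι → Finset V) (w : ι → ℝ) (x : V ⊕ ι ⊕ ι) : ℝ :=
  ∑ y, wG inc w x y

/-- Out-volume of a node subset in the gadget graph. -/
noncomputable def volG (inc : ι → Finset V) (w : ι → ℝ) (T : Finset (V ⊕ ι ⊕ ι)) : ℝ :=
  ∑ x ∈ T, outdegG inc w x

/-- Conductance of a node subset in the gadget graph. -/
noncomputable def phiG (inc : ι → Finset V) (w : ι → ℝ) (T : Finset (V ⊕ ι ⊕ ι)) : ℝ :=
  cutG inc w T / min (volG inc w T) (volG inc w Tᶜ)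

/-- Membership in the family `𝒯`: every auxiliary node of `T` has an in- or out-neighbor
among the original vertices of `T`. -/
def memT (inc : ι → Finset V) (w : ι → ℝ) (T : Finset (V ⊕ ι ⊕ ι)) : Prop :=
  ∀ c : ι ⊕ ι, Sum.inr c ∈ T → ∃ v : V, Sum.inl v ∈ T ∧
    (wG inc w (Sum.inr c) (Sum.inl v) ≠ 0 ∨ wG inc w (Sum.inl v) (Sum.inr c) ≠ 0)

/-- The cut of the gadget graph, grouped by hyperedge. -/
lemma cutG_eq_sum_hyperedges (inc : ι → Finset V) (w : ι → ℝ) (U : Finset (V ⊕ ι ⊕ ι)) :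
    cutG inc w U = ∑ e,
      ((∑ v ∈ inc e, if Sum.inl v ∈ U ∧ Sum.inr (Sum.inl e) ∉ U then (1 : ℝ) else 0) +
        (if Sum.inr (Sum.inl e) ∈ U ∧ Sum.inr (Sum.inr e) ∉ U then w e else 0) +
        ∑ v ∈ inc e, if Sum.inr (Sum.inr e) ∈ U ∧ Sum.inl v ∉ U then (1 : ℝ) else 0) := by
  have hcut : cutG inc w U = ∑ x, ∑ y, if x ∈ U ∧ y ∉ U then wG inc w x y else 0 := by
    simp only [cutG, ite_and, sum_ite_irrel, sum_const_zero]
    rw [← sum_filter, filter_univ_mem]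
    refine sum_congr rfl fun x _ => ?_
    rw [← sum_filter]
    congr 1
    ext y
    simp
  have hloop (e e' : ι) : (if Sum.inr (Sum.inl e) ∈ U ∧ Sum.inr (Sum.inl e') ∉ U then
      (if e = e' then 1 - w e else 0) else 0) = 0 := by
    split_ifs <;> simp_all
  have hmid (e : ι) : (∑ e', if Sum.inr (Sum.inl e) ∈ U ∧ Sum.inr (Sum.inr e') ∉ U then
      (if e = e' then w e else 0) else 0) =
      if Sum.inr (Sum.inl e) ∈ U ∧ Sum.inr (Sum.inr e) ∉ U then w e else 0 := by
    rw [sum_eq_single e] <;> simp +contextual [eq_comm]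
  have hinc (e : ι) (p : V → Prop) [DecidablePred p] :
      (∑ v ∈ inc e, if p v then (1 : ℝ) else 0) =
        ∑ v, if p v then (if v ∈ inc e then 1 else 0) else 0 := by
    rw [← filter_univ_mem (inc e), sum_filter]
    refine sum_congr rfl fun v _ => ?_
    simp only [filter_univ_mem]
    split_ifs <;> rfl
  simp only [hcut, Fintype.sum_sum_type, wG, ite_self, sum_const_zero, hloop, hmid, hinc,
    sum_add_distrib, zero_add, add_zero]
  rw [sum_comm (s := (univ : Finset V))]
  ring

lemma cutH_le_cutG (inc : ι → Finset V) (w : ι → ℝ)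
    (hwpos : ∀ e, 0 < w e) (hwle : ∀ e, w e ≤ 1) (S : Finset V)
    (T : Finset (V ⊕ ι ⊕ ι)) (hT : ∀ v : V, Sum.inl v ∈ T ↔ v ∈ S) :
    cutH inc w S ≤ cutG inc w T := by
  rw [cutG_eq_sum_hyperedges, cutH, sum_filter]
  refine sum_le_sum fun e _ => ?_
  simp only [hT]
  have hind (p : V → Prop) [DecidablePred p] :
      0 ≤ ∑ v ∈ inc e, if p v then (1 : ℝ) else 0 :=
    sum_nonneg fun v _ => by split_ifs <;> norm_num
  have hone (p : V → Prop) [DecidablePred p] (v : V) (hv : v ∈ inc e) (hp : p v) :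
      1 ≤ ∑ v ∈ inc e, if p v then (1 : ℝ) else 0 := by
    have := single_le_sum (f := fun v => if p v then (1 : ℝ) else 0)
      (fun v _ => by split_ifs <;> norm_num) hv
    simpa [hp] using this
  have hout := hind fun v => v ∈ S ∧ Sum.inr (Sum.inl e) ∉ T
  have hin := hind fun v => Sum.inr (Sum.inr e) ∈ T ∧ v ∉ S
  have hmid : 0 ≤ if Sum.inr (Sum.inl e) ∈ T ∧ Sum.inr (Sum.inr e) ∉ T then w e else 0 := by
    split_ifs
    exacts [(hwpos e).le, le_rfl]
  by_cases hsplit : (inc e ∩ S).Nonempty ∧ (inc e \ S).Nonempty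
  · rw [if_pos hsplit]
    obtain ⟨⟨u, hu⟩, ⟨v, hv⟩⟩ := hsplit
    rw [mem_inter] at hu
    rw [mem_sdiff] at hv
    have hw := hwle e
    by_cases ha : Sum.inr (Sum.inl e) ∈ T
    · by_cases hb : Sum.inr (Sum.inr e) ∈ T
      · have := hone (fun v => Sum.inr (Sum.inr e) ∈ T ∧ v ∉ S) v hv.1 ⟨hb, hv.2⟩
        linarith
      · rw [if_pos ⟨ha, hb⟩]
        linarith
    · have := hone (fun v => v ∈ S ∧ Sum.inr (Sum.inl e) ∉ T) u hu.1 ⟨hu.2, ha⟩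
      linarith
  · rw [if_neg hsplit]
    positivity

/-- The cut value of `S` is attained by adding `a_e` for every hyperedge meeting `S` and `b_e` for
every hyperedge contained in `S`. -/
lemma exists_cutG_eq_cutH (inc : ι → Finset V) (w : ι → ℝ) (S : Finset V) :
    ∃ U : Finset (V ⊕ ι ⊕ ι), (∀ v : V, Sum.inl v ∈ U ↔ v ∈ S) ∧ cutH inc w S = cutG inc w U := by
  refine ⟨S.disjSum ((univ.filter fun e => (inc e ∩ S).Nonempty).disjSum
    (univ.filter fun e => ¬ (inc e \ S).Nonempty)), fun v => by simp, ?_⟩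
  rw [cutG_eq_sum_hyperedges, cutH, sum_filter]
  refine sum_congr rfl fun e _ => ?_
  simp only [inl_mem_disjSum, inr_mem_disjSum, mem_filter_univ, not_not]
  rw [sum_eq_zero, sum_eq_zero, zero_add, add_zero]
  · exact fun v hv => if_neg fun h => h.1 ⟨v, mem_sdiff.2 ⟨hv, h.2⟩⟩
  · exact fun v hv => if_neg fun h => h.2 ⟨v, mem_inter.2 ⟨hv, h.1⟩⟩

/-- For every `S ⊆ V`, `cut_H(S)` is the minimum of `cut_G(U)` over all
`U ⊆ V̂` with `U ∩ V = S` (i.e. it is attained and is a lower bound); in particular every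
`T ⊆ V̂` with `T ∩ V = S` satisfies `cut_G(T) ≥ cut_H(S)`. -/
theorem cutH_isLeast_cutG
    (inc : ι → Finset V) (w : ι → ℝ)
    (hcard : ∀ e, 2 ≤ (inc e).card)
    (hwpos : ∀ e, 0 < w e) (hwle : ∀ e, w e ≤ 1)
    (S : Finset V) :
    IsLeast {c : ℝ | ∃ U : Finset (V ⊕ ι ⊕ ι),
        (∀ v : V, Sum.inl v ∈ U ↔ v ∈ S) ∧ c = cutG inc w U} (cutH inc w S) ∧
      ∀ T : Finset (V ⊕ ι ⊕ ι), (∀ v : V, Sum.inl v ∈ T ↔ v ∈ S) →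
        cutH inc w S ≤ cutG inc w T := by
  have hle := cutH_le_cutG inc w hwpos hwle S
  refine ⟨⟨exists_cutG_eq_cutH inc w S, ?_⟩, hle⟩
  rintro _ ⟨U, hU, rfl⟩
  exact hle U hU
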